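/- arXiv:1711.03432 — 3 statements merged into one kernel-verified Lean document; each statement's English description precedes it below -/
import Mathlib

section
/- For every n ≥ 1, the map π from Γ_{n+1} to Γ_n deleting the last letter of a word is a 3-sheeted normal (Galois) covering of Schreier graphs of the Fabrykowski–Gupta group with Galois group ℤ/3ℤ. Precisely: (i) π(s(w)) = s(π(w)) for every generator s ∈ {a,a⁻¹,b,b⁻¹} and word w of length n+1; (ii) for each k ∈ ℤ/3ℤ the map σ_k sending u·x to u·((x+k) mod 3) satisfies s(σ_k(w)) = σ_k(s(w)) for every generator s and every word w of length n+1, so each σ_k is a graph automorphism of Γ_{n+1}; (iii) {σ_0,σ_1,σ_2} is a cyclic group of order 3 under composition satisfying π∘σ_k = π and acting simply transitively on each fiber π⁻¹(u) = {u·0, u·1, u·2}. -/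
/-- The generator `a` of the Fabrykowski–Gupta group: `a(xw)=((x+1) mod 3)·w`. -/
def fgA : List (Fin 3) → List (Fin 3)
  | [] => []
  | x :: w => (x + 1) :: w

/-- The inverse generator `a⁻¹`: `a⁻¹(xw)=((x-1) mod 3)·w`. -/
def fgAinv : List (Fin 3) → List (Fin 3)
  | [] => []
  | x :: w => (x - 1) :: w

/-- The generator `b`: `b(0w)=0·a(w)`, `b(1w)=1·b(w)`, `b(2w)=2·w`. -/
def fgB : List (Fin 3) → List (Fin 3)
  | [] => []
  | x :: w => if x = 0 then x :: fgA w else if x = 1 then x :: fgB w else x :: w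

/-- The inverse generator `b⁻¹`: `b⁻¹(0w)=0·a⁻¹(w)`, `b⁻¹(1w)=1·b⁻¹(w)`, `b⁻¹(2w)=2·w`. -/
def fgBinv : List (Fin 3) → List (Fin 3)
  | [] => []
  | x :: w => if x = 0 then x :: fgAinv w else if x = 1 then x :: fgBinv w else x :: w

/-- The map `σ_k`, sending `u·x` to `u·((x+k) mod 3)`. -/
def shiftLast3 (k : Fin 3) (w : List (Fin 3)) : List (Fin 3) :=
  w.dropLast ++ [w.getLastD 0 + k]

theorem fgA_append_singleton {v : List (Fin 3)} (hv : v ≠ []) (x : Fin 3) :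
    fgA (v ++ [x]) = fgA v ++ [x] := by
  cases v with
  | nil => contradiction
  | cons y v => simp [fgA]

theorem fgAinv_append_singleton {v : List (Fin 3)} (hv : v ≠ []) (x : Fin 3) :
    fgAinv (v ++ [x]) = fgAinv v ++ [x] := by
  cases v with
  | nil => contradiction
  | cons y v => simp [fgAinv]

theorem exists_fgB_append_singleton (v : List (Fin 3)) :
    ∃ c : Fin 3, ∀ x, fgB (v ++ [x]) = fgB v ++ [x + c] := by
  induction v with
  | nil => exact ⟨0, fun x => by simp [fgB, fgA]⟩
  | cons y v ih =>
    obtain ⟨c, hc⟩ := ih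
    by_cases h0 : y = 0
    · by_cases hv : v = []
      · exact ⟨1, fun x => by simp [fgB, fgA, h0, hv]⟩
      · exact ⟨0, fun x => by simp [fgB, h0, fgA_append_singleton hv]⟩
    · by_cases h1 : y = 1
      · exact ⟨c, fun x => by simp [fgB, h1, hc]⟩
      · exact ⟨0, fun x => by simp [fgB, h0, h1]⟩

theorem exists_fgBinv_append_singleton (v : List (Fin 3)) :
    ∃ c : Fin 3, ∀ x, fgBinv (v ++ [x]) = fgBinv v ++ [x + c] := by
  induction v with
  | nil => exact ⟨0, fun x => by simp [fgBinv, fgAinv]⟩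
  | cons y v ih =>
    obtain ⟨c, hc⟩ := ih
    by_cases h0 : y = 0
    · by_cases hv : v = []
      · exact ⟨-1, fun x => by simp [fgBinv, fgAinv, h0, hv, sub_eq_add_neg]⟩
      · exact ⟨0, fun x => by simp [fgBinv, h0, fgAinv_append_singleton hv]⟩
    · by_cases h1 : y = 1
      · exact ⟨c, fun x => by simp [fgBinv, h1, hc]⟩
      · exact ⟨0, fun x => by simp [fgBinv, h0, h1]⟩

/-- Each generator acts on the last letter of a word of length at least two by a translation
that depends only on the preceding letters. -/
theorem exists_generator_append_singleton {s : List (Fin 3) → List (Fin 3)}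
    (hs : s ∈ [fgA, fgAinv, fgB, fgBinv]) {v : List (Fin 3)} (hv : v ≠ []) :
    ∃ c : Fin 3, ∀ x, s (v ++ [x]) = s v ++ [x + c] := by
  simp only [List.mem_cons, List.not_mem_nil, or_false] at hs
  rcases hs with rfl | rfl | rfl | rfl
  · exact ⟨0, fun x => by rw [fgA_append_singleton hv, add_zero]⟩
  · exact ⟨0, fun x => by rw [fgAinv_append_singleton hv, add_zero]⟩
  · exact exists_fgB_append_singleton v
  · exact exists_fgBinv_append_singleton v

theorem shiftLast3_append_singleton (k : Fin 3) (v : List (Fin 3)) (x : Fin 3) :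
    shiftLast3 k (v ++ [x]) = v ++ [x + k] := by
  simp [shiftLast3]

theorem exists_eq_append_singleton_of_length {n : ℕ} {w : List (Fin 3)}
    (hw : w.length = n + 1) : ∃ v x, v.length = n ∧ w = v ++ [x] := by
  rcases List.eq_nil_or_concat w with rfl | ⟨v, x, rfl⟩
  · simp at hw
  · exact ⟨v, x, by simpa using hw, by simp⟩

/-- For every `n ≥ 1`, deleting the last letter is a 3-sheeted normal (Galois) covering
`Γ_{n+1} → Γ_n` of Schreier graphs of the Fabrykowski–Gupta group, with Galois group
`ℤ/3ℤ = {σ_0,σ_1,σ_2}` acting simply transitively on the fibers. -/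
theorem fabrykowskiGupta_galois_covering (n : ℕ) (hn : 1 ≤ n) :
    (∀ s ∈ [fgA, fgAinv, fgB, fgBinv], ∀ w : List (Fin 3), w.length = n + 1 →
        (s w).dropLast = s w.dropLast) ∧
    (∀ k : Fin 3, ∀ s ∈ [fgA, fgAinv, fgB, fgBinv], ∀ w : List (Fin 3), w.length = n + 1 →
        s (shiftLast3 k w) = shiftLast3 k (s w)) ∧
    (∀ w : List (Fin 3), w.length = n + 1 → shiftLast3 0 w = w) ∧
    (∀ j k : Fin 3, ∀ w : List (Fin 3), w.length = n + 1 →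
        shiftLast3 j (shiftLast3 k w) = shiftLast3 (j + k) w) ∧
    (∀ k : Fin 3, k ≠ 0 → ∀ w : List (Fin 3), w.length = n + 1 → shiftLast3 k w ≠ w) ∧
    (∀ k : Fin 3, ∀ w : List (Fin 3), w.length = n + 1 →
        (shiftLast3 k w).dropLast = w.dropLast) ∧
    (∀ u : List (Fin 3), u.length = n → ∀ w : List (Fin 3),
        (w.length = n + 1 ∧ w.dropLast = u) ↔ ∃ x : Fin 3, w = u ++ [x]) ∧
    (∀ w w' : List (Fin 3), w.length = n + 1 → w'.length = n + 1 →
        w.dropLast = w'.dropLast → ∃! k : Fin 3, shiftLast3 k w = w') := by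
  refine ⟨?_, ?_, ?_, ?_, ?_, ?_, ?_, ?_⟩
  · intro s hs w hw
    obtain ⟨v, x, hv, rfl⟩ := exists_eq_append_singleton_of_length hw
    obtain ⟨c, hc⟩ := exists_generator_append_singleton hs
      (List.ne_nil_of_length_pos (by omega : 0 < v.length))
    simp [hc]
  · intro k s hs w hw
    obtain ⟨v, x, hv, rfl⟩ := exists_eq_append_singleton_of_length hw
    obtain ⟨c, hc⟩ := exists_generator_append_singleton hs
      (List.ne_nil_of_length_pos (by omega : 0 < v.length))
    simp only [shiftLast3_append_singleton, hc, add_right_comm]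
  · intro w hw
    obtain ⟨v, x, -, rfl⟩ := exists_eq_append_singleton_of_length hw
    rw [shiftLast3_append_singleton, add_zero]
  · intro j k w hw
    obtain ⟨v, x, -, rfl⟩ := exists_eq_append_singleton_of_length hw
    simp only [shiftLast3_append_singleton, add_assoc, add_comm k j]
  · intro k hk w hw
    obtain ⟨v, x, -, rfl⟩ := exists_eq_append_singleton_of_length hw
    simpa [shiftLast3_append_singleton] using hk
  · intro k w _
    simp [shiftLast3]
  · intro u hu w
    constructor
    · rintro ⟨hw, rfl⟩
      obtain ⟨v, x, -, rfl⟩ := exists_eq_append_singleton_of_length hw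
      exact ⟨x, by simp⟩
    · rintro ⟨x, rfl⟩
      simp [hu]
  · intro w w' hw hw' h
    obtain ⟨v, x, -, rfl⟩ := exists_eq_append_singleton_of_length hw
    obtain ⟨v', x', -, rfl⟩ := exists_eq_append_singleton_of_length hw'
    obtain rfl : v = v' := by simpa using h
    refine ⟨x' - x, by simp [shiftLast3_append_singleton], fun k hk => ?_⟩
    have hk' : x + k = x' := by simpa [shiftLast3_append_singleton] using hk
    rw [← hk', add_sub_cancel_left]
end

section
/- For every n ≥ 1, the map π from Γ_{n+1} to Γ_n deleting the last letter of a word is a 2-sheeted normal (Galois) covering of Schreier graphs of the linear-automaton group with Galois group ℤ/2ℤ. Precisely: (i) π(s(w)) = s(π(w)) for every generator s ∈ {a,a⁻¹,b,b⁻¹} and every word w of length n+1; (ii) the last-letter flip σ (mapping u·x to u·(1−x)) satisfies s(σ(w)) = σ(s(w)) for every generator s and every word w of length n+1, so σ is a graph automorphism of Γ_{n+1}; (iii) σ∘σ = id, σ has no fixed point, π∘σ = π, and {id, σ} acts transitively on each fiber π⁻¹(u) = {u·0, u·1}. -/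
/-- The generator `a` of the linear-automaton group: `a(0w)=1·a(w)`, `a(1w)=0·w`. -/
def linA : List (Fin 2) → List (Fin 2)
  | [] => []
  | x :: w => if x = 0 then 1 :: linA w else 0 :: w

/-- The inverse generator `a⁻¹`: `a⁻¹(1w)=0·a⁻¹(w)`, `a⁻¹(0w)=1·w`. -/
def linAinv : List (Fin 2) → List (Fin 2)
  | [] => []
  | x :: w => if x = 1 then 0 :: linAinv w else 1 :: w

/-- The generator `b`: `b(0w)=0·b(w)`, `b(1w)=1·a(w)`. -/
def linB : List (Fin 2) → List (Fin 2)
  | [] => []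
  | x :: w => if x = 0 then 0 :: linB w else 1 :: linA w

/-- The inverse generator `b⁻¹`: `b⁻¹(0w)=0·b⁻¹(w)`, `b⁻¹(1w)=1·a⁻¹(w)`. -/
def linBinv : List (Fin 2) → List (Fin 2)
  | [] => []
  | x :: w => if x = 0 then 0 :: linBinv w else 1 :: linAinv w

/-- The last-letter flip `σ`, mapping `u·x` to `u·(1-x)`. -/
def flipLast (w : List (Fin 2)) : List (Fin 2) :=
  w.dropLast ++ [1 - w.getLastD 0]

/-- `s` acts on `u·x` by `s` on `u` and by a translation, depending only on `u`, on `x`. -/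
def TranslatesLast (s : List (Fin 2) → List (Fin 2)) : Prop :=
  ∀ u, ∃ c : Fin 2, ∀ x, s (u ++ [x]) = s u ++ [x + c]

theorem translatesLast_linA : TranslatesLast linA := by
  intro u
  induction u with
  | nil => exact ⟨1, by decide⟩
  | cons y u ih =>
    obtain ⟨c, hc⟩ := ih
    by_cases hy : y = 0
    · exact ⟨c, fun x => by simp [linA, hy, hc]⟩
    · exact ⟨0, fun x => by simp [linA, hy]⟩

theorem translatesLast_linAinv : TranslatesLast linAinv := by
  intro u
  induction u with
  | nil => exact ⟨1, by decide⟩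
  | cons y u ih =>
    obtain ⟨c, hc⟩ := ih
    by_cases hy : y = 1
    · exact ⟨c, fun x => by simp [linAinv, hy, hc]⟩
    · exact ⟨0, fun x => by simp [linAinv, hy]⟩

theorem translatesLast_linB : TranslatesLast linB := by
  intro u
  induction u with
  | nil => exact ⟨0, by decide⟩
  | cons y u ih =>
    by_cases hy : y = 0
    · obtain ⟨c, hc⟩ := ih
      exact ⟨c, fun x => by simp [linB, hy, hc]⟩
    · obtain ⟨c, hc⟩ := translatesLast_linA u
      exact ⟨c, fun x => by simp [linB, hy, hc]⟩

theorem translatesLast_linBinv : TranslatesLast linBinv := by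
  intro u
  induction u with
  | nil => exact ⟨0, by decide⟩
  | cons y u ih =>
    by_cases hy : y = 0
    · obtain ⟨c, hc⟩ := ih
      exact ⟨c, fun x => by simp [linBinv, hy, hc]⟩
    · obtain ⟨c, hc⟩ := translatesLast_linAinv u
      exact ⟨c, fun x => by simp [linBinv, hy, hc]⟩

theorem translatesLast_of_mem_generators {s : List (Fin 2) → List (Fin 2)}
    (hs : s ∈ [linA, linAinv, linB, linBinv]) : TranslatesLast s := by
  simp only [List.mem_cons, List.not_mem_nil, or_false] at hs
  rcases hs with rfl | rfl | rfl | rfl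
  exacts [translatesLast_linA, translatesLast_linAinv, translatesLast_linB,
    translatesLast_linBinv]

theorem flipLast_append_singleton (u : List (Fin 2)) (x : Fin 2) :
    flipLast (u ++ [x]) = u ++ [1 - x] := by
  simp [flipLast]

theorem exists_eq_append_singleton {α : Type*} {n : ℕ} {w : List α} (hw : w.length = n + 1) :
    ∃ u x, w = u ++ [x] := by
  have h : w ≠ [] := List.ne_nil_of_length_eq_add_one hw
  exact ⟨w.dropLast, w.getLast h, (List.dropLast_append_getLast h).symm⟩

/-- For every `n ≥ 1`, deleting the last letter is a 2-sheeted normal (Galois) covering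
`Γ_{n+1} → Γ_n` of Schreier graphs of the linear-automaton group, with Galois group
`ℤ/2ℤ` generated by the last-letter flip `σ = flipLast`. -/
theorem linearAutomaton_galois_covering (n : ℕ) (hn : 1 ≤ n) :
    (∀ s ∈ [linA, linAinv, linB, linBinv], ∀ w : List (Fin 2), w.length = n + 1 →
        (s w).dropLast = s w.dropLast) ∧
    (∀ s ∈ [linA, linAinv, linB, linBinv], ∀ w : List (Fin 2), w.length = n + 1 →
        s (flipLast w) = flipLast (s w)) ∧
    (∀ w : List (Fin 2), w.length = n + 1 → flipLast (flipLast w) = w) ∧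
    (∀ w : List (Fin 2), w.length = n + 1 → flipLast w ≠ w) ∧
    (∀ w : List (Fin 2), w.length = n + 1 → (flipLast w).dropLast = w.dropLast) ∧
    (∀ u : List (Fin 2), u.length = n → ∀ w : List (Fin 2),
        (w.length = n + 1 ∧ w.dropLast = u) ↔ (w = u ++ [0] ∨ w = u ++ [1])) ∧
    (∀ w w' : List (Fin 2), w.length = n + 1 → w'.length = n + 1 →
        w.dropLast = w'.dropLast → w' = w ∨ w' = flipLast w) := by
  refine ⟨?_, ?_, ?_, ?_, ?_, ?_, ?_⟩
  · intro s hs w hw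
    obtain ⟨u, x, rfl⟩ := exists_eq_append_singleton hw
    obtain ⟨c, hc⟩ := translatesLast_of_mem_generators hs u
    simp [hc]
  · intro s hs w hw
    obtain ⟨u, x, rfl⟩ := exists_eq_append_singleton hw
    obtain ⟨c, hc⟩ := translatesLast_of_mem_generators hs u
    have h : ∀ x c : Fin 2, 1 - x + c = 1 - (x + c) := by decide
    rw [flipLast_append_singleton, hc, hc, flipLast_append_singleton, h]
  · intro w hw
    obtain ⟨u, x, rfl⟩ := exists_eq_append_singleton hw
    rw [flipLast_append_singleton, flipLast_append_singleton, sub_sub_cancel]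
  · intro w hw
    obtain ⟨u, x, rfl⟩ := exists_eq_append_singleton hw
    have h : ∀ x : Fin 2, 1 - x ≠ x := by decide
    simpa [flipLast_append_singleton] using h x
  · intro w hw
    obtain ⟨u, x, rfl⟩ := exists_eq_append_singleton hw
    simp [flipLast_append_singleton]
  · intro u hu w
    constructor
    · rintro ⟨hw, rfl⟩
      obtain ⟨u, x, rfl⟩ := exists_eq_append_singleton hw
      have h : ∀ x : Fin 2, x = 0 ∨ x = 1 := by decide
      simpa using h x
    · rintro (rfl | rfl) <;> simp [hu]
  · intro w w' hw hw' h
    obtain ⟨u, x, rfl⟩ := exists_eq_append_singleton hw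
    obtain ⟨u', x', rfl⟩ := exists_eq_append_singleton hw'
    have huu : u = u' := by simpa using h
    subst huu
    have hx : ∀ x x' : Fin 2, x' = x ∨ x' = 1 - x := by decide
    simpa [flipLast_append_singleton] using hx x x'
end

section
/- Let A₂ be the level-2 Schreier adjacency matrix of the Gupta–Sidki 3-group, i.e., the 9×9 integer matrix indexed by words of length 2 over {0,1,2} with A₂(u,v) = #{s ∈ {a,a⁻¹,b,b⁻¹} : s(u) = v}. Then, as an identity of polynomials in t over ℤ, det(I₉ − t·A₂ + 3t²·I₉) = (t−1)(3t−1)(3t²−t+1)²(3t²+2t+1)²(9t⁴−6t³+4t²−2t+1)². (This is the determinant factor in the Ihara–Bass formula for the Ihara zeta function of the level-2 Schreier graph Γ₂ of the Gupta–Sidki 3-group, computed via the Artin L-functions of the ℤ/3ℤ-Galois covering Γ₂|Γ₁.) -/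
/-- The generator `b` of the Gupta–Sidki 3-group: `b(xw)=((x+1) mod 3)·w`. -/
def gsB : List (Fin 3) → List (Fin 3)
  | [] => []
  | x :: w => (x + 1) :: w

/-- The inverse generator `b⁻¹`: `b⁻¹(xw)=((x-1) mod 3)·w`. -/
def gsBinv : List (Fin 3) → List (Fin 3)
  | [] => []
  | x :: w => (x - 1) :: w

/-- The generator `a`: `a(0w)=0·b(w)`, `a(1w)=1·b⁻¹(w)`, `a(2w)=2·a(w)`. -/
def gsA : List (Fin 3) → List (Fin 3)
  | [] => []
  | x :: w => if x = 0 then x :: gsB w else if x = 1 then x :: gsBinv w else x :: gsA w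

/-- The inverse generator `a⁻¹`: `a⁻¹(0w)=0·b⁻¹(w)`, `a⁻¹(1w)=1·b(w)`, `a⁻¹(2w)=2·a⁻¹(w)`. -/
def gsAinv : List (Fin 3) → List (Fin 3)
  | [] => []
  | x :: w => if x = 0 then x :: gsBinv w else if x = 1 then x :: gsB w else x :: gsAinv w

open Polynomial

/-- The generating set `{a, a⁻¹, b, b⁻¹}` of the Gupta–Sidki 3-group. -/
def gsGens : List (List (Fin 3) → List (Fin 3)) := [gsA, gsAinv, gsB, gsBinv]

/-- The level-2 Schreier adjacency matrix `A₂` of the Gupta–Sidki 3-group, indexed by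
words `u₁u₂` of length 2 over `{0,1,2}`:
`A₂(u,v) = #{s ∈ {a,a⁻¹,b,b⁻¹} : s(u) = v}`. -/
def gsAdj2 : Matrix (Fin 3 × Fin 3) (Fin 3 × Fin 3) ℤ :=
  fun u v => (gsGens.countP (fun s => decide (s [u.1, u.2] = [v.1, v.2])) : ℤ)

/-- The adjacency matrix of the triangle, over any commutative ring. -/
def triangleAdj (R : Type*) [CommRing R] : Matrix (Fin 3) (Fin 3) R :=
  !![0, 1, 1; 1, 0, 1; 1, 1, 0]

theorem det_aeval_triangleAdj {R : Type*} [CommRing R] (α β : R) :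
    (aeval (triangleAdj R) (C α + C β * X)).det = (α + 2 * β) * (α - β) ^ 2 := by
  simp only [map_add, map_mul, aeval_C, aeval_X, Algebra.algebraMap_eq_smul_one,
    triangleAdj, Matrix.det_fin_three]
  simp
  ring

/-- The matrix `1 - t A₂ + 3t²` written as a `3 × 3` matrix over `ℤ[t][Y]`, with rows and columns
indexed by the first letter and `Y` standing for the triangle adjacency matrix on the second
letter. -/
noncomputable def iharaBlock : Matrix (Fin 3) (Fin 3) ℤ[X][X] :=
  !![C (1 + 3 * X ^ 2) + C (-X) * X, C (-X), C (-X);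
     C (-X), C (1 + 3 * X ^ 2) + C (-X) * X, C (-X);
     C (-X), C (-X), C (1 + 3 * X ^ 2 - 2 * X)]

theorem gsAdj2_apply (u v : Fin 3 × Fin 3) :
    gsAdj2 u v =
      if u.1 = v.1 then
        if u.1 = 2 then if u.2 = v.2 then 2 else 0 else if u.2 = v.2 then 0 else 1
      else if u.2 = v.2 then 1 else 0 := by
  obtain ⟨i, j⟩ := u
  obtain ⟨k, l⟩ := v
  revert i j k l
  decide

theorem iharaMatrix_eq_comp :
    (1 : Matrix (Fin 3 × Fin 3) (Fin 3 × Fin 3) ℤ[X]) - (X : ℤ[X]) • (gsAdj2.map C)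
        + (3 * X ^ 2 : ℤ[X]) • (1 : Matrix (Fin 3 × Fin 3) (Fin 3 × Fin 3) ℤ[X])
      = Matrix.comp (Fin 3) (Fin 3) (Fin 3) (Fin 3) ℤ[X]
          (iharaBlock.map (aeval (triangleAdj ℤ[X])).toRingHom) := by
  ext1 ⟨i, j⟩ ⟨k, l⟩
  simp only [Matrix.add_apply, Matrix.sub_apply, Matrix.smul_apply, Matrix.map_apply,
    Matrix.comp_apply, gsAdj2_apply, Matrix.one_apply, Prod.mk.injEq, smul_eq_mul]
  fin_cases i <;> fin_cases k <;>
    simp only [iharaBlock, AlgHom.toRingHom_eq_coe, RingHom.coe_coe, Matrix.of_apply,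
      Matrix.cons_val, Fin.reduceFinMk, Fin.zero_eta, Fin.mk_one, Fin.isValue,
      map_add (aeval _), map_mul (aeval _), aeval_C, aeval_X,
      Algebra.algebraMap_eq_smul_one] <;>
    fin_cases j <;> fin_cases l <;> simp [triangleAdj] <;> ring

theorem det_iharaBlock :
    iharaBlock.det = (C (1 + X + 3 * X ^ 2) + C (-X) * X) *
      (C ((1 + 3 * X ^ 2) * (1 + 3 * X ^ 2 - 2 * X) - X * (1 + 3 * X ^ 2 - 2 * X) - 2 * X ^ 2)
        + C (-X * (1 + 3 * X ^ 2 - 2 * X)) * X) := by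
  simp only [iharaBlock, Matrix.det_fin_three, Matrix.of_apply, Matrix.cons_val, C_add, C_sub,
    C_mul, C_neg, C_pow, C_1, map_ofNat C]
  ring

/-- The determinant factor in the Ihara–Bass formula for the Ihara zeta function of
the level-2 Schreier graph `Γ₂` of the Gupta–Sidki 3-group:
`det(I₉ − t·A₂ + 3t²·I₉) = (t−1)(3t−1)(3t²−t+1)²(3t²+2t+1)²(9t⁴−6t³+4t²−2t+1)²`. -/
theorem guptaSidki_level2_ihara_det :
    Matrix.det
      ((1 : Matrix (Fin 3 × Fin 3) (Fin 3 × Fin 3) (Polynomial ℤ))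
        - (X : Polynomial ℤ) • (gsAdj2.map C)
        + (3 * X ^ 2 : Polynomial ℤ) •
            (1 : Matrix (Fin 3 × Fin 3) (Fin 3 × Fin 3) (Polynomial ℤ)))
      = (X - 1) * (3 * X - 1) * (3 * X ^ 2 - X + 1) ^ 2 * (3 * X ^ 2 + 2 * X + 1) ^ 2
        * (9 * X ^ 4 - 6 * X ^ 3 + 4 * X ^ 2 - 2 * X + 1) ^ 2 := by
  rw [iharaMatrix_eq_comp, ← Matrix.det_det, det_iharaBlock]
  simp only [AlgHom.toRingHom_eq_coe, RingHom.coe_coe]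
  rw [map_mul, Matrix.det_mul, det_aeval_triangleAdj, det_aeval_triangleAdj]
  ring
end
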